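/- arXiv:1003.2898 — 2 statements merged into one kernel-verified Lean document; each statement's English description precedes it below -/
import Mathlib

section
/- Overlap coincidence needs only be checked on overlaps arising from a basis of translation vectors: let T = Λ + 𝒜 be a self-affine tiling with Ξ a Meyer set, and let B = {α₁,…,α_d} ⊂ Ξ be a basis of ℝ^d. Call a triple (u,y,v) with u ∈ Λ_i, v ∈ Λ_j, y ∈ Ξ an overlap if the interiors of u + A_i − y and v + A_j intersect, and say that its ℓ-th inflation contains a coincidence if there exist p ≤ m, d ∈ (Dˡ)_{pi} and d′ ∈ (Dˡ)_{pj} with Qˡ(u − y) + d = Qˡ v + d′. Then the following are equivalent: (i) there exists ℓ ∈ ℤ₊ such that for every overlap (u,y,v), its ℓ-th inflation contains a coincidence (T admits an overlap coincidence); (ii) for every α ∈ B, every n ≥ 0, and every overlap of the form (u, Qⁿα, v), there exists ℓ = ℓ(u, Qⁿα, v) such that its ℓ-th inflation contains a coincidence. -/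
open Pointwise Set

noncomputable section

def UniformlyDiscrete {X : Type*} [PseudoMetricSpace X] (S : Set X) : Prop :=
  ∃ r > 0, ∀ x ∈ S, ∀ y ∈ S, x ≠ y → r ≤ dist x y

def RelativelyDense {X : Type*} [PseudoMetricSpace X] (S : Set X) : Prop :=
  ∃ R > 0, ∀ x : X, ∃ y ∈ S, dist x y ≤ R

def IsDelone {X : Type*} [PseudoMetricSpace X] (S : Set X) : Prop :=
  UniformlyDiscrete S ∧ RelativelyDense S

/-- Iterated digit sets: `iterD Q D n i j` is `(Dⁿ)_{ij}`. -/
def iterD {E : Type*} [AddCommGroup E] {m : ℕ}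
    (Q : E → E) (D : Fin m → Fin m → Set E) : ℕ → Fin m → Fin m → Set E
  | 0 => fun i j => if i = j then {0} else ∅
  | n + 1 => fun i j => ⋃ l : Fin m, D i l + Q '' iterD Q D n l j

/-! ### Helper material for the proof -/

/-- The normalized hypotheses on a self-affine tiling used in the proof. -/
structure TSys {E : Type*} [NormedAddCommGroup E] [NormedSpace ℝ E] {m : ℕ}
    (Q : E ≃L[ℝ] E) (D : Fin m → Fin m → Set E) (Λ A : Fin m → Set E) : Prop where
  clos : ∀ i, A i = closure (interior (A i))
  ne : ∀ i, (A i).Nonempty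
  sub : ∀ i j a e, a ∈ Λ j → e ∈ D i j → Q a + e ∈ Λ i
  tile : ∀ j z, z ∈ A j → ∃ i, ∃ e ∈ D i j, Q z - e ∈ A i
  tile' : ∀ i j e z, e ∈ D i j → z ∈ A i → ∃ w ∈ A j, Q w = e + z
  cover : ∀ x, ∃ i, ∃ a ∈ Λ i, x - a ∈ A i
  uniq : ∀ i i' a a' z, a ∈ Λ i → a' ∈ Λ i' → z - a ∈ interior (A i) →
    z - a' ∈ interior (A i') → i = i' ∧ a = a'

section helpers

variable {E : Type*} [NormedAddCommGroup E] [NormedSpace ℝ E] {m : ℕ}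
  {Q : E ≃L[ℝ] E} {D : Fin m → Fin m → Set E} {Λ A : Fin m → Set E}

lemma mem_int_vadd (a z : E) (S : Set E) : z ∈ interior (a +ᵥ S) ↔ z - a ∈ interior S := by
  rw [interior_vadd, Set.mem_vadd_set_iff_neg_vadd_mem, vadd_eq_add, neg_add_eq_sub]

lemma mem_vadd' (a z : E) (S : Set E) : z ∈ (a +ᵥ S) ↔ z - a ∈ S := by
  rw [Set.mem_vadd_set_iff_neg_vadd_mem, vadd_eq_add, neg_add_eq_sub]

lemma it_sub (Q : E ≃L[ℝ] E) (n : ℕ) (x y : E) :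
    (⇑Q)^[n] (x - y) = (⇑Q)^[n] x - (⇑Q)^[n] y := iterate_map_sub Q n x y

lemma it_add (Q : E ≃L[ℝ] E) (n : ℕ) (x y : E) :
    (⇑Q)^[n] (x + y) = (⇑Q)^[n] x + (⇑Q)^[n] y := iterate_map_add Q n x y

lemma it_symm (Q : E ≃L[ℝ] E) (n : ℕ) (x : E) :
    (⇑Q)^[n] ((⇑Q.symm)^[n] x) = x :=
  (Function.RightInverse.iterate (f := Q) (g := Q.symm) (fun x => Q.apply_symm_apply x) n) x

lemma symm_it (Q : E ≃L[ℝ] E) (n : ℕ) (x : E) :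
    (⇑Q.symm)^[n] ((⇑Q)^[n] x) = x :=
  (Function.LeftInverse.iterate (f := Q) (g := Q.symm) (fun x => Q.symm_apply_apply x) n) x

lemma open_it (Q : E ≃L[ℝ] E) (n : ℕ) : IsOpenMap (⇑Q)^[n] := by
  induction n with
  | zero => exact IsOpenMap.id
  | succ n ih => exact ih.comp Q.toHomeomorph.isOpenMap

lemma cont_it (Q : E ≃L[ℝ] E) (n : ℕ) : Continuous (⇑Q)^[n] := Q.continuous.iterate n

lemma contract {Q : E ≃L[ℝ] E} (hexp : ∃ k : ℕ, 1 ≤ k ∧ ‖(Q.symm : E →L[ℝ] E) ^ k‖ < 1)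
    (M ε : ℝ) (hε : 0 < ε) : ∃ n : ℕ, ∀ z : E, ‖z‖ ≤ M → ‖(⇑Q.symm)^[n] z‖ < ε := by
  obtain ⟨k, hk, h1⟩ := hexp
  have hM : 0 < |M| + 1 := by positivity
  obtain ⟨j, hj⟩ := exists_pow_lt_of_lt_one (div_pos hε hM) h1
  refine ⟨k * j, fun z hz => ?_⟩
  have e : (⇑Q.symm)^[k * j] z = (((Q.symm : E →L[ℝ] E) ^ k) ^ j) z := by
    rw [← pow_mul]
    generalize k * j = N
    induction N with
    | zero => simp
    | succ N ih => rw [Function.iterate_succ_apply', ih, pow_succ']; rfl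
  rw [e]
  have h2 : ‖((Q.symm : E →L[ℝ] E) ^ k) ^ j‖ ≤ ‖(Q.symm : E →L[ℝ] E) ^ k‖ ^ j := by
    rcases Nat.eq_zero_or_pos j with rfl | hj0
    · rw [pow_zero, pow_zero]
      exact ContinuousLinearMap.norm_id_le
    · exact norm_pow_le' _ hj0
  calc _ ≤ ‖((Q.symm : E →L[ℝ] E) ^ k) ^ j‖ * ‖z‖ := ContinuousLinearMap.le_opNorm _ _
    _ ≤ ‖((Q.symm : E →L[ℝ] E) ^ k)‖ ^ j * (|M| + 1) := by
        gcongr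
        linarith [le_abs_self M]
    _ < ε := by rwa [lt_div_iff₀ hM] at hj

/-- All iterates of `x` lie in interiors of tiles. -/
def Good (Q : E ≃L[ℝ] E) (Λ A : Fin m → Set E) (x : E) : Prop :=
  ∀ n : ℕ, ∃ p, ∃ a ∈ Λ p, (⇑Q)^[n] x - a ∈ interior (A p)

/-- The level `n` tiles at `x` and `x'` agree up to translation by `x' - x`. -/
def AgN (Q : E ≃L[ℝ] E) (Λ A : Fin m → Set E) (n : ℕ) (x x' : E) : Prop :=
  ∃ p, ∃ a ∈ Λ p, ∃ a' ∈ Λ p, (⇑Q)^[n] x - a ∈ interior (A p) ∧ a' - a = (⇑Q)^[n] (x' - x)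

lemma TSys.uniq' (h : TSys Q D Λ A) {i i' : Fin m} {a a' z : E} (ha : a ∈ Λ i) (ha' : a' ∈ Λ i')
    (h1 : z - a ∈ interior (A i)) (h2 : z - a' ∈ A i') : i = i' ∧ a = a' := by
  rw [h.clos i'] at h2
  have hV : IsOpen {w : E | w + a' - a ∈ interior (A i)} :=
    isOpen_interior.preimage (by fun_prop)
  obtain ⟨w, hw1, hw2⟩ := mem_closure_iff.1 h2 _ hV (by simpa using h1)
  exact h.uniq i i' a a' (w + a') ha ha' hw1 (by simpa using hw2)

lemma TSys.good (h : TSys Q D Λ A) : ∀ᶠ x in residual E, Good Q Λ A x := by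
  have hW : ∀ᶠ x in residual E, ∃ p, ∃ a ∈ Λ p, x - a ∈ interior (A p) := by
    refine residual_of_dense_open (s := {x | ∃ p, ∃ a ∈ Λ p, x - a ∈ interior (A p)}) ?_ ?_
    · have : {x | ∃ p, ∃ a ∈ Λ p, x - a ∈ interior (A p)} =
          ⋃ p, ⋃ a ∈ Λ p, {x | x - a ∈ interior (A p)} := by ext; simp
      rw [this]
      refine isOpen_iUnion fun p => isOpen_iUnion fun a => isOpen_iUnion fun _ => ?_
      exact isOpen_interior.preimage (by fun_prop)
    · intro x
      rw [mem_closure_iff]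
      intro U hU hx
      obtain ⟨i, a, ha, hxa⟩ := h.cover x
      rw [h.clos i] at hxa
      obtain ⟨w, hw1, hw2⟩ := mem_closure_iff.1 hxa {w | w + a ∈ U}
        (hU.preimage (by fun_prop)) (by simpa using hx)
      exact ⟨w + a, hw1, i, a, ha, by simpa using hw2⟩
  unfold Good
  rw [eventually_countable_forall]
  intro n
  exact (tendsto_residual_of_isOpenMap (cont_it Q n) (open_it Q n)).eventually hW

/-- Subdividing a tile containing a good point. -/
lemma TSys.step (h : TSys Q D Λ A) {n : ℕ} {x : E} (hx : Good Q Λ A x) {p : Fin m} {a : E}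
    (ha : a ∈ Λ p) (h1 : (⇑Q)^[n] x - a ∈ A p) :
    ∃ i, ∃ e ∈ D i p, (⇑Q)^[n+1] x - (Q a + e) ∈ interior (A i) := by
  obtain ⟨i, e, he, h2⟩ := h.tile p _ h1
  refine ⟨i, e, he, ?_⟩
  obtain ⟨i', a', ha', h3⟩ := hx (n+1)
  have h4 : (⇑Q)^[n+1] x - (Q a + e) ∈ A i := by
    rw [Function.iterate_succ_apply']
    rw [map_sub] at h2
    rwa [← sub_sub]
  obtain ⟨rfl, rfl⟩ := h.uniq' ha' (h.sub i p a e ha he) h3 h4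
  exact h3

lemma TSys.ag_succ (h : TSys Q D Λ A) {n : ℕ} {x x' : E} (hx : Good Q Λ A x)
    (hA : AgN Q Λ A n x x') : AgN Q Λ A (n+1) x x' := by
  obtain ⟨p, a, ha, a', ha', h1, h2⟩ := hA
  obtain ⟨i, e, he, h3⟩ := h.step hx ha (interior_subset h1)
  refine ⟨i, Q a + e, h.sub i p a e ha he, Q a' + e, h.sub i p a' e ha' he, h3, ?_⟩
  rw [Function.iterate_succ_apply', ← h2, map_sub]; abel

lemma TSys.ag_mono (h : TSys Q D Λ A) {n k : ℕ} (hnk : n ≤ k) {x x' : E} (hx : Good Q Λ A x)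
    (hA : AgN Q Λ A n x x') : AgN Q Λ A k x x' := by
  induction k, hnk using Nat.le_induction with
  | base => exact hA
  | succ k _ ih => exact h.ag_succ hx ih

lemma ag_symm {n : ℕ} {x x' : E} (hA : AgN Q Λ A n x x') : AgN Q Λ A n x' x := by
  obtain ⟨p, a, ha, a', ha', h1, h2⟩ := hA
  refine ⟨p, a', ha', a, ha, ?_, ?_⟩
  · rw [it_sub] at h2
    have : (⇑Q)^[n] x' - a' = (⇑Q)^[n] x - a := by
      rw [sub_eq_sub_iff_add_eq_add, ← sub_eq_zero]
      have h3 := sub_eq_zero.2 h2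
      rw [← neg_eq_zero, ← h3]
      abel
    rwa [this]
  · rw [it_sub] at h2 ⊢
    rw [← neg_sub, h2, neg_sub]

lemma TSys.ag_trans (h : TSys Q D Λ A) {n : ℕ} {x y z : E} (h1 : AgN Q Λ A n x y)
    (h2 : AgN Q Λ A n y z) : AgN Q Λ A n x z := by
  obtain ⟨p, b, hb, a, ha, hy, hab⟩ := ag_symm h1
  obtain ⟨p', b', hb', c, hc, hy', hbc⟩ := h2
  obtain ⟨rfl, rfl⟩ := h.uniq _ _ _ _ _ hb hb' hy hy'
  obtain ⟨q, a1, ha1, b1, hb1, hx, hab1⟩ := h1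
  have hxa : (⇑Q)^[n] x - a = (⇑Q)^[n] y - b := by
    rw [it_sub] at hab
    rw [sub_eq_sub_iff_add_eq_add, ← sub_eq_zero]
    have h3 := sub_eq_zero.2 hab
    rw [← neg_eq_zero, ← h3]
    abel
  refine ⟨p, a, ha, c, hc, by rwa [hxa], ?_⟩
  have e1 : c - a = (c - b) - (a - b) := by abel
  rw [e1, hab, hbc, ← it_sub]
  congr 1; abel

/-- Agreement at some level. -/
def Ag (Q : E ≃L[ℝ] E) (Λ A : Fin m → Set E) (x x' : E) : Prop := ∃ n, AgN Q Λ A n x x'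

lemma Ag.symm' {x y : E} (h1 : Ag Q Λ A x y) : Ag Q Λ A y x := by
  obtain ⟨n, hn⟩ := h1
  exact ⟨n, ag_symm hn⟩

lemma TSys.trans (h : TSys Q D Λ A) {x y z : E} (hx : Good Q Λ A x) (hy : Good Q Λ A y)
    (h1 : Ag Q Λ A x y) (h2 : Ag Q Λ A y z) : Ag Q Λ A x z := by
  obtain ⟨n, hn⟩ := h1
  obtain ⟨k, hk⟩ := h2
  exact ⟨max n k, h.ag_trans (h.ag_mono (le_max_left _ _) hx hn)
    (h.ag_mono (le_max_right _ _) hy hk)⟩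

lemma ag_scale {K : ℕ} {x y : E} (h : Ag Q Λ A ((⇑Q)^[K] x) ((⇑Q)^[K] y)) : Ag Q Λ A x y := by
  obtain ⟨n, p, a, ha, a', ha', h1, h2⟩ := h
  refine ⟨n + K, p, a, ha, a', ha', ?_, ?_⟩
  · rwa [Function.iterate_add_apply]
  · rw [Function.iterate_add_apply, it_sub Q K, h2]

lemma ev_trans {P : E → Prop} (h : ∀ᶠ x in residual E, P x) (w : E) :
    ∀ᶠ x in residual E, P (x + w) :=
  (tendsto_residual_of_isOpenMap (Homeomorph.addRight w).continuous
    (Homeomorph.addRight w).isOpenMap).eventually h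

lemma ev_it {P : E → Prop} (h : ∀ᶠ x in residual E, P x) (Q : E ≃L[ℝ] E) (n : ℕ) :
    ∀ᶠ x in residual E, P ((⇑Q)^[n] x) :=
  (tendsto_residual_of_isOpenMap (cont_it Q n) (open_it Q n)).eventually h

lemma TSys.closure (h : TSys Q D Λ A) {S : Set E}
    (hS : ∀ w ∈ S, ∀ᶠ x in residual E, Ag Q Λ A x (x + w)) {w : E}
    (hw : w ∈ AddSubgroup.closure S) : ∀ᶠ x in residual E, Ag Q Λ A x (x + w) := by
  induction hw using AddSubgroup.closure_induction with
  | mem x hx => exact hS x hx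
  | zero =>
    filter_upwards [h.good] with x hx
    obtain ⟨p, a, ha, h1⟩ := hx 0
    exact ⟨0, p, a, ha, a, ha, h1, by simp⟩
  | add y z _ _ hy hz =>
    filter_upwards [h.good, ev_trans h.good y, hy, ev_trans hz y] with x h1 h2 h3 h4
    rw [← add_assoc]
    exact h.trans h1 h2 h3 h4
  | neg y _ hy =>
    filter_upwards [ev_trans hy (-y)] with x hx
    simpa using hx.symm'

/-- The tile of a good point at level `n` is a digit tile of its level zero tile. -/
lemma TSys.digit (h : TSys Q D Λ A) {x : E} (hx : Good Q Λ A x) {j : Fin m} {v : E}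
    (hv : v ∈ Λ j) (hxv : x - v ∈ interior (A j)) (n : ℕ) :
    ∃ p, ∃ e ∈ iterD (⇑Q) D n p j, (⇑Q)^[n] v + e ∈ Λ p ∧
      (⇑Q)^[n] x - ((⇑Q)^[n] v + e) ∈ interior (A p) := by
  induction n with
  | zero => exact ⟨j, 0, by simp [iterD], by simpa using hv, by simpa using hxv⟩
  | succ n ih =>
    obtain ⟨p, e, he, h1, h2⟩ := ih
    obtain ⟨i, f, hf, h3⟩ := h.step hx h1 (interior_subset h2)
    have e1 : Q ((⇑Q)^[n] v + e) + f = (⇑Q)^[n+1] v + (f + Q e) := by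
      rw [map_add, Function.iterate_succ_apply']; abel
    refine ⟨i, f + Q e, ?_, ?_, ?_⟩
    · simp only [iterD, mem_iUnion]
      exact ⟨p, Set.add_mem_add hf (mem_image_of_mem _ he)⟩
    · rw [← e1]; exact h.sub _ _ _ _ h1 hf
    · rw [← e1]; exact h3

lemma TSys.digit_mem (h : TSys Q D Λ A) {j : Fin m} {v : E} (hv : v ∈ Λ j) (n : ℕ) :
    ∀ p e, e ∈ iterD (⇑Q) D n p j → (⇑Q)^[n] v + e ∈ Λ p ∧
      ∀ z ∈ A p, ∃ w ∈ A j, (⇑Q)^[n] w = e + z := by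
  induction n with
  | zero =>
    intro p e he
    by_cases hpj : p = j
    · subst hpj
      have he0 : e = 0 := by simpa [iterD] using he
      subst he0
      exact ⟨by simpa using hv, fun z hz => ⟨z, hz, by simp⟩⟩
    · simp [iterD, hpj] at he
  | succ n ih =>
    intro p e he
    simp only [iterD, mem_iUnion] at he
    obtain ⟨l, f, hf, _, ⟨g, hg, rfl⟩, rfl⟩ := he
    obtain ⟨h1, h2⟩ := ih l g hg
    refine ⟨?_, fun z hz => ?_⟩
    · have := h.sub _ _ _ _ h1 hf
      rw [map_add] at this
      rw [Function.iterate_succ_apply']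
      convert this using 1
      simp only []
      abel
    · obtain ⟨w, hw, hw2⟩ := h.tile' _ _ _ _ hf hz
      obtain ⟨w', hw', hw3⟩ := h2 w hw
      refine ⟨w', hw', ?_⟩
      rw [Function.iterate_succ_apply', hw3, map_add, hw2]
      simp only []
      abel

lemma TSys.col (h : TSys Q D Λ A) (j : Fin m) : ∃ i, (D i j).Nonempty := by
  obtain ⟨z, hz⟩ := h.ne j
  obtain ⟨i, e, he, _⟩ := h.tile j z hz
  exact ⟨i, e, he⟩

lemma TSys.xi (h : TSys Q D Λ A) {y : E} (hy : y ∈ ⋃ i, (Λ i - Λ i)) (n : ℕ) :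
    (⇑Q)^[n] y ∈ ⋃ i, (Λ i - Λ i) := by
  induction n with
  | zero => exact hy
  | succ n ih =>
    rw [Function.iterate_succ_apply']
    obtain ⟨i, a, ha, b, hb, hab⟩ := mem_iUnion.1 ih
    obtain ⟨k, e, he⟩ := h.col i
    refine mem_iUnion.2 ⟨k, Q a + e, h.sub _ _ _ _ ha he, Q b + e, h.sub _ _ _ _ hb he, ?_⟩
    simp only [] at hab ⊢
    rw [← hab, map_sub]; abel

/-- Coincidence at level `ℓ` in terms of the displacement `s = u - y - v`. -/
def Coin (Q : E ≃L[ℝ] E) (D : Fin m → Fin m → Set E) (ℓ : ℕ) (i j : Fin m) (s : E) : Prop :=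
  ∃ p : Fin m, ∃ dd ∈ iterD (⇑Q) D ℓ p i, ∃ dd' ∈ iterD (⇑Q) D ℓ p j, (⇑Q)^[ℓ] s + dd = dd'

lemma coin_iff (ℓ : ℕ) (i j : Fin m) (x v : E) : Coin Q D ℓ i j (x - v) ↔
    ∃ p : Fin m, ∃ dd ∈ iterD (⇑Q) D ℓ p i, ∃ dd' ∈ iterD (⇑Q) D ℓ p j,
        (⇑Q)^[ℓ] x + dd = (⇑Q)^[ℓ] v + dd' := by
  have : ∀ a b c e : E, a - b + c = e ↔ a + c = b + e := by
    intro a b c e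
    rw [sub_add_eq_add_sub, sub_eq_iff_eq_add, add_comm e b]
  simp only [Coin, it_sub, this]

lemma TSys.coin_mono (h : TSys Q D Λ A) {ℓ k : ℕ} (hk : ℓ ≤ k) {i j : Fin m} {s : E}
    (hc : Coin Q D ℓ i j s) : Coin Q D k i j s := by
  induction k, hk using Nat.le_induction with
  | base => exact hc
  | succ k _ ih =>
    obtain ⟨p, a, ha, b, hb, hab⟩ := ih
    obtain ⟨q, e, he⟩ := h.col p
    refine ⟨q, e + Q a, ?_, e + Q b, ?_, ?_⟩
    · simp only [iterD, mem_iUnion]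
      exact ⟨p, Set.add_mem_add he (mem_image_of_mem _ ha)⟩
    · simp only [iterD, mem_iUnion]
      exact ⟨p, Set.add_mem_add he (mem_image_of_mem _ hb)⟩
    · rw [Function.iterate_succ_apply', ← hab, map_add]; abel

/-- Density of agreement for a vector satisfying the coincidence condition. -/
lemma TSys.basis_ev [BaireSpace E] (h : TSys Q D Λ A)
    (hexp : ∃ k : ℕ, 1 ≤ k ∧ ‖(Q.symm : E →L[ℝ] E) ^ k‖ < 1)
    {M : ℝ} (hM : ∀ i, ∀ z ∈ A i, ‖z‖ ≤ M) {α : E}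
    (hα : ∀ (n : ℕ) (i j : Fin m) (u v : E), u ∈ Λ i → v ∈ Λ j →
      (interior ((u - (⇑Q)^[n] α) +ᵥ A i) ∩ interior (v +ᵥ A j)).Nonempty →
      ∃ ℓ, Coin Q D ℓ i j (u - (⇑Q)^[n] α - v)) :
    ∀ᶠ x in residual E, Ag Q Λ A x (x + α) := by
  refine residual_of_dense_open (s := {x | Ag Q Λ A x (x + α)}) ?_ ?_
  · have : {x | Ag Q Λ A x (x + α)} = ⋃ n : ℕ, ⋃ p, ⋃ a ∈ Λ p, ⋃ a' ∈ Λ p,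
        ⋃ (_ : a' - a = (⇑Q)^[n] α), {x | (⇑Q)^[n] x - a ∈ interior (A p)} := by
      ext x
      simp only [Ag, AgN, mem_setOf_eq, mem_iUnion, add_sub_cancel_left, exists_prop]
      constructor
      · rintro ⟨n, p, a, ha, a', ha', h1, h2⟩
        exact ⟨n, p, a, ha, a', ha', h2, h1⟩
      · rintro ⟨n, p, a, ha, a', ha', h2, h1⟩
        exact ⟨n, p, a, ha, a', ha', h1, h2⟩
    rw [this]
    refine isOpen_iUnion fun n => isOpen_iUnion fun p => isOpen_iUnion fun a => isOpen_iUnion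
      fun _ => isOpen_iUnion fun a' => isOpen_iUnion fun _ => isOpen_iUnion fun _ => ?_
    exact isOpen_interior.preimage ((cont_it Q n).sub continuous_const)
  · rw [Metric.dense_iff]
    intro x0 ε hε
    obtain ⟨n, hn⟩ := contract hexp (M + M) (ε / 2) (half_pos hε)
    obtain ⟨x, hx, hxg, hxg'⟩ := Metric.dense_iff.1
      (dense_of_mem_residual (h.good.and (ev_trans h.good α))) x0 (ε / 2) (half_pos hε)
    obtain ⟨j, v, hv, hxv⟩ := hxg n
    obtain ⟨i, u, hu, hxu⟩ := hxg' n
    obtain ⟨ℓ, hℓ⟩ := hα n i j u v hu hv ⟨(⇑Q)^[n] x, by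
      rw [mem_int_vadd]
      rw [it_add] at hxu
      convert hxu using 1
      abel, by rwa [mem_int_vadd]⟩
    rw [coin_iff] at hℓ
    obtain ⟨p, dd, hdd, dd', hdd', he⟩ := hℓ
    obtain ⟨hc', -⟩ := h.digit_mem hu ℓ p dd hdd
    obtain ⟨hc, hcov⟩ := h.digit_mem hv ℓ p dd' hdd'
    have hne : (interior (A p)).Nonempty := by
      rw [← closure_nonempty_iff, ← h.clos p]; exact h.ne p
    obtain ⟨z, hz⟩ := hne
    obtain ⟨w, hw, hwz⟩ := hcov z (interior_subset hz)
    refine ⟨(⇑Q.symm)^[n] (v + w), ?_, ℓ + n, p, _, hc, _, hc', ?_, ?_⟩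
    · have h3 : dist ((⇑Q.symm)^[n] (v + w)) x < ε / 2 := by
        have : (⇑Q.symm)^[n] (v + w) - x = (⇑Q.symm)^[n] (w - ((⇑Q)^[n] x - v)) := by
          conv_lhs => rw [← symm_it Q n x, ← it_sub Q.symm]
          congr 1; abel
        rw [dist_eq_norm, this]
        apply hn
        exact (norm_sub_le _ _).trans (add_le_add (hM j w hw) (hM j _ (interior_subset hxv)))
      have h4 : dist x x0 < ε / 2 := hx
      rw [Metric.mem_ball]
      linarith [dist_triangle ((⇑Q.symm)^[n] (v + w)) x x0]
    · rw [Function.iterate_add_apply, it_symm, it_add, hwz]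
      convert hz using 1
      abel
    · rw [← he, add_sub_cancel_left, Function.iterate_add_apply, it_sub]; abel

/-- Every overlap eventually has a coincidence. -/
lemma TSys.overlap [BaireSpace E] (h : TSys Q D Λ A)
    (hexp : ∃ k : ℕ, 1 ≤ k ∧ ‖(Q.symm : E →L[ℝ] E) ^ k‖ < 1)
    {S : Set E} {C : ℝ} (hC : ∀ x, ∃ w ∈ AddSubgroup.closure S, ‖x - w‖ ≤ C)
    (hS : ∀ w ∈ S, ∀ᶠ x in residual E, Ag Q Λ A x (x + w))
    {i j : Fin m} {u v y : E} (hu : u ∈ Λ i) (hv : v ∈ Λ j) (hy : y ∈ ⋃ i, (Λ i - Λ i))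
    (hne : (interior ((u - y) +ᵥ A i) ∩ interior (v +ᵥ A j)).Nonempty) :
    ∃ ℓ, Coin Q D ℓ i j (u - y - v) := by
  obtain ⟨k, a, ha, b, hb, hab⟩ := mem_iUnion.1 hy
  simp only [] at hab
  obtain ⟨x0, hx0⟩ := hne
  have hne : (interior (A k)).Nonempty := by
    rw [← closure_nonempty_iff, ← h.clos k]; exact h.ne k
  obtain ⟨c, hc⟩ := hne
  obtain ⟨r, hr, hball⟩ := Metric.isOpen_iff.1 isOpen_interior c hc
  obtain ⟨K, hK⟩ := contract hexp C r hr
  obtain ⟨w, hw, hwC⟩ := hC ((⇑Q)^[K] (b + c - x0))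
  set w' := (⇑Q.symm)^[K] w with hw'
  have hx0w : x0 + w' - b ∈ interior (A k) := by
    apply hball
    rw [Metric.mem_ball, dist_comm, dist_eq_norm]
    have : c - (x0 + w' - b) = (⇑Q.symm)^[K] ((⇑Q)^[K] (b + c - x0) - w) := by
      rw [it_sub Q.symm, symm_it]; abel
    rw [this]
    exact hK _ hwC
  have hOpen : IsOpen ((interior ((u - y) +ᵥ A i) ∩ interior (v +ᵥ A j)) ∩
      {x | x + w' - b ∈ interior (A k)}) :=
    (isOpen_interior.inter isOpen_interior).inter (isOpen_interior.preimage (by fun_prop))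
  have hA1 : ∀ᶠ x in residual E, Ag Q Λ A x (x + w') := by
    filter_upwards [ev_it (h.closure hS hw) Q K] with x hx
    apply ag_scale (K := K)
    rwa [it_add, hw', it_symm]
  have hev := h.good.and ((ev_trans h.good y).and ((ev_trans h.good w').and
    ((ev_trans h.good (w' + y)).and (hA1.and (ev_trans hA1 y)))))
  obtain ⟨x, ⟨⟨hxu, hxv⟩, hxw⟩, g1, g2, g3, g4, r1, r2⟩ :=
    (dense_of_mem_residual hev).inter_open_nonempty _ hOpen ⟨x0, hx0, hx0w⟩
  rw [mem_int_vadd] at hxu hxv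
  have r3 : Ag Q Λ A (x + w') (x + y + w') :=
    ⟨0, k, b, hb, a, ha, hxw, by simp only [Function.iterate_zero, id_eq]; rw [hab]; abel⟩
  have g5 : Good Q Λ A (x + y + w') := by
    convert g4 using 1; abel
  obtain ⟨n, p, c1, hc1, c2, hc2, h1, h2⟩ := h.trans g1 g3 r1 (h.trans g3 g5 r3 r2.symm')
  refine ⟨n, (coin_iff _ _ _ _ _).2 ?_⟩
  obtain ⟨p1, d1, hd1, hd1m, hd1i⟩ := h.digit g1 hv hxv n
  obtain ⟨p2, d2, hd2, hd2m, hd2i⟩ := h.digit (x := x + y) g2 hu (by convert hxu using 1; abel) n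
  obtain ⟨rfl, e1⟩ := h.uniq _ _ _ _ _ hc1 hd1m h1 hd1i
  rw [add_sub_cancel_left] at h2
  have h3 : (⇑Q)^[n] (x + y) - c2 ∈ interior (A p) := by
    convert h1 using 1
    rw [it_add, ← h2]; abel
  obtain ⟨rfl, e2⟩ := h.uniq _ _ _ _ _ hc2 hd2m h3 hd2i
  refine ⟨p, d2, hd2, d1, hd1, ?_⟩
  rw [← e1, it_sub, ← h2, sub_add_eq_add_sub, ← e2]; abel

lemma ud_finite [ProperSpace E] {S : Set E} (hS : UniformlyDiscrete S) (R : ℝ) :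
    (S ∩ Metric.closedBall 0 R).Finite := by
  obtain ⟨r, hr, hd⟩ := hS
  obtain ⟨t, -, ht, hcov⟩ := Metric.finite_approx_of_totallyBounded
    (isCompact_closedBall (0 : E) R).totallyBounded (r / 2) (half_pos hr)
  refine Set.Finite.subset (ht.biUnion (t := fun c => S ∩ Metric.ball c (r / 2)) ?_) ?_
  · intro c _
    apply Set.Subsingleton.finite
    rintro x ⟨hx, hxc⟩ y ⟨hy, hyc⟩
    by_contra hne
    have := hd x hx y hy hne
    rw [Metric.mem_ball] at hxc hyc
    linarith [dist_triangle_right x y c]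
  · rintro x ⟨hx, hxR⟩
    obtain ⟨c, hc, hxc⟩ := mem_iUnion₂.1 (hcov hxR)
    exact mem_iUnion₂.2 ⟨c, hc, hx, hxc⟩

/-- Finitely many overlaps up to translation. -/
lemma overlap_finite [ProperSpace E] (hDel : ∀ i, IsDelone (Λ i))
    (hXi : UniformlyDiscrete ((⋃ i, (Λ i - Λ i)) - ⋃ i, (Λ i - Λ i)))
    {M : ℝ} (hM : ∀ i, ∀ z ∈ A i, ‖z‖ ≤ M) (i j : Fin m) :
    {s : E | ∃ u ∈ Λ i, ∃ v ∈ Λ j, ∃ y ∈ ⋃ i, (Λ i - Λ i),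
      (interior ((u - y) +ᵥ A i) ∩ interior (v +ᵥ A j)).Nonempty ∧ s = u - y - v}.Finite := by
  obtain ⟨R, hR, hRd⟩ := (hDel i).2
  obtain ⟨u0, hu0, -⟩ := hRd 0
  obtain ⟨R', hR', hRd'⟩ := (hDel j).2
  obtain ⟨v0, hv0, -⟩ := hRd' 0
  set X := (⋃ i, (Λ i - Λ i)) - ⋃ i, (Λ i - Λ i) with hX
  have f1 := ud_finite hXi (M + M + R)
  have f2 := ud_finite hXi (R + ‖u0 - v0‖)
  refine ((f1.add f2).image (fun s => s + (u0 - v0))).subset ?_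
  rintro s ⟨u, hu, v, hv, y, hy, ⟨z, hz1, hz2⟩, rfl⟩
  rw [mem_int_vadd] at hz1 hz2
  obtain ⟨u', hu', hd⟩ := hRd v
  rw [dist_eq_norm] at hd
  have n1 : ‖u - y - v‖ ≤ M + M := by
    have : u - y - v = (z - v) - (z - (u - y)) := by abel
    rw [this]
    exact (norm_sub_le _ _).trans (add_le_add (hM _ _ (interior_subset hz2))
      (hM _ _ (interior_subset hz1)))
  refine ⟨(u - u' - y) + ((u' - u0) - (v - v0)), Set.add_mem_add ⟨?_, ?_⟩ ⟨?_, ?_⟩, ?_⟩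
  · exact Set.sub_mem_sub (mem_iUnion.2 ⟨i, Set.sub_mem_sub hu hu'⟩) hy
  · rw [mem_closedBall_zero_iff]
    have : u - u' - y = (u - y - v) + (v - u') := by abel
    rw [this]
    exact (norm_add_le _ _).trans (add_le_add n1 hd)
  · exact Set.sub_mem_sub (mem_iUnion.2 ⟨i, Set.sub_mem_sub hu' hu0⟩)
      (mem_iUnion.2 ⟨j, Set.sub_mem_sub hv hv0⟩)
  · rw [mem_closedBall_zero_iff]
    have : (u' - u0) - (v - v0) = -(v - u') - (u0 - v0) := by abel
    rw [this]
    refine (norm_sub_le _ _).trans (add_le_add ?_ le_rfl)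
    rwa [norm_neg]
  · simp only []
    abel

end helpers

/-- overlap coincidence needs only be checked on the overlaps whose
translation vector is an inflation `Qⁿα` of a vector of a basis `B ⊆ Ξ` of `ℝ^d`:
(i) some fixed inflation `Φ^ℓ` of every overlap contains a coincidence, iff
(ii) for every overlap of the form `(u, Qⁿα, v)` with `α ∈ B`, some inflation of it
contains a coincidence. -/
theorem stmt_13 (d m : ℕ) (hd : 1 ≤ d) (hm : 1 ≤ m)
    (Q : EuclideanSpace ℝ (Fin d) ≃L[ℝ] EuclideanSpace ℝ (Fin d))
    (hexp : ∃ k : ℕ, 1 ≤ k ∧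
      ‖(Q.symm : EuclideanSpace ℝ (Fin d) →L[ℝ] EuclideanSpace ℝ (Fin d)) ^ k‖ < 1)
    (D : Fin m → Fin m → Set (EuclideanSpace ℝ (Fin d)))
    (hDfin : ∀ i j, (D i j).Finite)
    (Λ : Fin m → Set (EuclideanSpace ℝ (Fin d)))
    (hDel : ∀ i, IsDelone (Λ i)) (hDelU : IsDelone (⋃ i, Λ i))
    (hsub : ∀ i, Λ i = ⋃ j, ⇑Q '' Λ j + D i j)
    (hdisjsub : ∀ i : Fin m, ∀ j j' : Fin m, ∀ x ∈ D i j, ∀ x' ∈ D i j',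
      (j, x) ≠ (j', x') → Disjoint (x +ᵥ ⇑Q '' Λ j) (x' +ᵥ ⇑Q '' Λ j'))
    (hprim : ∃ p : ℕ, 1 ≤ p ∧ ∀ i j : Fin m,
      0 < ((Matrix.of fun i j : Fin m => (D i j).ncard) ^ p) i j)
    (hrep : ∀ K : Set (EuclideanSpace ℝ (Fin d)), IsCompact K →
      RelativelyDense { t : EuclideanSpace ℝ (Fin d) | ∀ i, (t +ᵥ Λ i) ∩ K = Λ i ∩ K })
    (A : Fin m → Set (EuclideanSpace ℝ (Fin d)))
    (hAne : ∀ i, (A i).Nonempty) (hAcp : ∀ i, IsCompact (A i))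
    (hAint : ∀ i, A i = closure (interior (A i)))
    (htile : ∀ j, ⇑Q '' A j = ⋃ i, D i j + A i)
    (hcover : (⋃ i, ⋃ x ∈ Λ i, x +ᵥ A i) = univ)
    (htdisj : ∀ i i' : Fin m, ∀ x ∈ Λ i, ∀ x' ∈ Λ i',
      (i, x) ≠ (i', x') → interior (x +ᵥ A i) ∩ interior (x' +ᵥ A i') = ∅)
    (hXiDel : IsDelone (⋃ i, (Λ i - Λ i)))
    (hXiMeyer : UniformlyDiscrete ((⋃ i, (Λ i - Λ i)) - ⋃ i, (Λ i - Λ i)))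
    (B : Fin d → EuclideanSpace ℝ (Fin d))
    (hBXi : ∀ t, B t ∈ ⋃ i, (Λ i - Λ i))
    (hBli : LinearIndependent ℝ B)
    (hBsp : Submodule.span ℝ (Set.range B) = ⊤) :
    (∃ ℓ : ℕ, 1 ≤ ℓ ∧ ∀ (i j : Fin m) (u v y : EuclideanSpace ℝ (Fin d)),
      u ∈ Λ i → v ∈ Λ j → y ∈ ⋃ i, (Λ i - Λ i) →
      (interior ((u - y) +ᵥ A i) ∩ interior (v +ᵥ A j)).Nonempty →
      ∃ p : Fin m, ∃ dd ∈ iterD (⇑Q) D ℓ p i, ∃ dd' ∈ iterD (⇑Q) D ℓ p j,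
        (⇑Q)^[ℓ] (u - y) + dd = (⇑Q)^[ℓ] v + dd') ↔
    (∀ (t : Fin d) (n : ℕ) (i j : Fin m) (u v : EuclideanSpace ℝ (Fin d)),
      u ∈ Λ i → v ∈ Λ j → (⇑Q)^[n] (B t) ∈ ⋃ i, (Λ i - Λ i) →
      (interior ((u - (⇑Q)^[n] (B t)) +ᵥ A i) ∩ interior (v +ᵥ A j)).Nonempty →
      ∃ ℓ : ℕ, ∃ p : Fin m, ∃ dd ∈ iterD (⇑Q) D ℓ p i, ∃ dd' ∈ iterD (⇑Q) D ℓ p j,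
        (⇑Q)^[ℓ] (u - (⇑Q)^[n] (B t)) + dd = (⇑Q)^[ℓ] v + dd') := by
  have hT : TSys Q D Λ A := by
    refine ⟨hAint, hAne, ?_, ?_, ?_, ?_, ?_⟩
    · intro i j a e ha he
      rw [hsub i]
      exact mem_iUnion.2 ⟨j, Set.add_mem_add (mem_image_of_mem _ ha) he⟩
    · intro j z hz
      have h1 : Q z ∈ ⇑Q '' A j := mem_image_of_mem _ hz
      rw [htile j] at h1
      obtain ⟨i, e, he, w, hw, hew⟩ := mem_iUnion.1 h1
      refine ⟨i, e, he, ?_⟩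
      simp only [] at hew
      rwa [← hew, add_sub_cancel_left]
    · intro i j e z he hz
      have h1 : e + z ∈ ⇑Q '' A j := by
        rw [htile j]
        exact mem_iUnion.2 ⟨i, Set.add_mem_add he hz⟩
      exact h1
    · intro x
      have h1 : x ∈ (⋃ i, ⋃ x ∈ Λ i, x +ᵥ A i) := by rw [hcover]; trivial
      simp only [mem_iUnion] at h1
      obtain ⟨i, a, ha, h2⟩ := h1
      exact ⟨i, a, ha, (mem_vadd' _ _ _).1 h2⟩
    · intro i i' a a' z ha ha' h1 h2
      by_contra hne
      have h3 := htdisj i i' a ha a' ha' (by simpa using hne)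
      have h4 : z ∈ interior (a +ᵥ A i) ∩ interior (a' +ᵥ A i') :=
        ⟨(mem_int_vadd _ _ _).2 h1, (mem_int_vadd _ _ _).2 h2⟩
      rw [h3] at h4
      exact h4
  obtain ⟨M, hM⟩ : ∃ M : ℝ, ∀ i, ∀ z ∈ A i, ‖z‖ ≤ M := by
    have hb : Bornology.IsBounded (⋃ i, A i) :=
      (isCompact_iUnion hAcp).isBounded
    obtain ⟨M, hM⟩ := isBounded_iff_forall_norm_le.1 hb
    exact ⟨M, fun i z hz => hM z (mem_iUnion.2 ⟨i, hz⟩)⟩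
  constructor
  · rintro ⟨ℓ, -, hℓ⟩ t n i j u v hu hv hy hne
    exact ⟨ℓ, hℓ i j u v _ hu hv hy hne⟩
  · intro hii
    have hC : ∃ C : ℝ, ∀ x, ∃ w ∈ AddSubgroup.closure (Set.range B), ‖x - w‖ ≤ C := by
      let b := Module.Basis.mk hBli hBsp.ge
      have hbB : ⇑b = B := Module.Basis.coe_mk _ _
      refine ⟨∑ i, ‖b i‖, fun x => ⟨ZSpan.floor b x, ?_, ?_⟩⟩
      · rw [← Submodule.span_int_eq_addSubgroupClosure, ← hbB]
        exact (ZSpan.floor b x).2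
      · rw [← ZSpan.fract_apply]
        exact ZSpan.norm_fract_le b x
    obtain ⟨C, hC⟩ := hC
    have hS : ∀ w ∈ Set.range B, ∀ᶠ x in residual _, Ag Q Λ A x (x + w) := by
      rintro _ ⟨t, rfl⟩
      refine hT.basis_ev hexp hM ?_
      intro n i j u v hu hv hne
      obtain ⟨ℓ, hℓ⟩ := hii t n i j u v hu hv (hT.xi (hBXi t) n) hne
      exact ⟨ℓ, (coin_iff _ _ _ _ _).2 hℓ⟩
    have hunif : ∀ i j : Fin m, ∃ N : ℕ, ∀ u ∈ Λ i, ∀ v ∈ Λ j, ∀ y ∈ ⋃ i, (Λ i - Λ i),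
        (interior ((u - y) +ᵥ A i) ∩ interior (v +ᵥ A j)).Nonempty →
        Coin Q D N i j (u - y - v) := by
      intro i j
      have hfin := overlap_finite hDel hXiMeyer hM i j
      have hex : ∀ s : EuclideanSpace ℝ (Fin d), ∃ ℓ : ℕ, s ∈ {s | ∃ u ∈ Λ i, ∃ v ∈ Λ j,
          ∃ y ∈ ⋃ i, (Λ i - Λ i), (interior ((u - y) +ᵥ A i) ∩
          interior (v +ᵥ A j)).Nonempty ∧ s = u - y - v} → Coin Q D ℓ i j s := by
        intro s
        by_cases hs : s ∈ {s | ∃ u ∈ Λ i, ∃ v ∈ Λ j,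
          ∃ y ∈ ⋃ i, (Λ i - Λ i), (interior ((u - y) +ᵥ A i) ∩
          interior (v +ᵥ A j)).Nonempty ∧ s = u - y - v}
        · obtain ⟨u, hu, v, hv, y, hy, hne, rfl⟩ := hs
          obtain ⟨ℓ, hℓ⟩ := hT.overlap hexp hC hS hu hv hy hne
          exact ⟨ℓ, fun _ => hℓ⟩
        · exact ⟨0, fun h => absurd h hs⟩
      choose f hf using hex
      obtain ⟨N, hN⟩ := (hfin.image f).bddAbove
      refine ⟨N, fun u hu v hv y hy hne => ?_⟩
      have hs := (⟨u, hu, v, hv, y, hy, hne, rfl⟩ : u - y - v ∈ {s | ∃ u ∈ Λ i, ∃ v ∈ Λ j,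
          ∃ y ∈ ⋃ i, (Λ i - Λ i), (interior ((u - y) +ᵥ A i) ∩
          interior (v +ᵥ A j)).Nonempty ∧ s = u - y - v})
      exact hT.coin_mono (hN (mem_image_of_mem f hs)) (hf _ hs)
    choose N hN using hunif
    refine ⟨(∑ i, ∑ j, N i j) + 1, by omega, ?_⟩
    intro i j u v y hu hv hy hne
    rw [← coin_iff]
    refine hT.coin_mono ?_ (hN i j u hu v hv y hy hne)
    have h1 : N i j ≤ ∑ j, N i j :=
      Finset.single_le_sum (f := fun j => N i j) (fun _ _ => Nat.zero_le _) (Finset.mem_univ j)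
    have h2 : ∑ j, N i j ≤ ∑ i, ∑ j, N i j :=
      Finset.single_le_sum (f := fun i => ∑ j, N i j) (fun _ _ => Nat.zero_le _)
        (Finset.mem_univ i)
    omega
end
end

section
/- Boundaries of tiles of a self-similar tiling have Hausdorff dimension strictly less than d: let T = Λ + 𝒜 be a self-similar tiling of ℝ^d, i.e. a self-affine tiling whose expansion map is Q = λO with λ > 1 and O a linear isometry of ℝ^d. Then for every i ≤ m the topological boundary ∂A_i of the tile A_i satisfies dim_H(∂A_i) < d. -/
open Pointwise Set

noncomputable section

theorem cover_dim {E : Type} [PseudoMetricSpace E] {m : ℕ}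
    (B : Fin m → Set E) (v : Fin m → ENNReal) (s c : NNReal)
    (T : Fin m → Finset (Fin m × E)) (f : Fin m × E → E → E) (hf : ∀ p, LipschitzWith c (f p))
    (hB : ∀ j, B j ⊆ ⋃ p ∈ T j, f p '' B p.1) (hv : ∀ j, Metric.ediam (B j) ^ (s:ℝ) ≤ v j)
    (C : ENNReal) (hC : ∀ j, Metric.ediam (B j) ≤ C)
    (hw : ∀ j, ∑ p ∈ T j, (c:ENNReal) ^ (s:ℝ) * v p.1 ≤ v j) (k : ℕ) :
    ∀ j, ∃ (ι : Type) (_ : Fintype ι) (t : ι → Set E), B j ⊆ ⋃ a, t a ∧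
      (∀ a, Metric.ediam (t a) ≤ (c:ENNReal)^k * C) ∧ ∑ a, Metric.ediam (t a) ^ (s:ℝ) ≤ v j := by
  induction k with
  | zero =>
    intro j
    refine ⟨Unit, inferInstance, fun _ => B j, ?_, ?_, ?_⟩
    · exact fun x hx => mem_iUnion.2 ⟨(), hx⟩
    · intro _; simpa using hC j
    · simpa using hv j
  | succ k ih =>
    intro j
    choose ι hι t ht1 ht2 ht3 using ih
    refine ⟨Σ p : T j, ι p.1.1, inferInstance, fun a => f a.1.1 '' t a.1.1.1 a.2, ?_, ?_, ?_⟩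
    · intro x hx
      obtain ⟨p, hp, y, hy, rfl⟩ := by simpa only [mem_iUnion, exists_prop] using hB j hx
      obtain ⟨a, ha⟩ := mem_iUnion.1 (ht1 p.1 hy)
      exact mem_iUnion.2 ⟨⟨⟨p, hp⟩, a⟩, y, ha, rfl⟩
    · rintro ⟨p, a⟩
      calc _ ≤ (c:ENNReal) * Metric.ediam (t p.1.1 a) := (hf p.1).ediam_image_le _
        _ ≤ c * (c^k * C) := by gcongr; exact ht2 _ _
        _ = _ := by ring
    · rw [Fintype.sum_sigma]
      refine le_trans ?_ (hw j)
      rw [← Finset.sum_coe_sort (T j) (fun p => (c:ENNReal) ^ (s:ℝ) * v p.1)]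
      refine Finset.sum_le_sum fun p _ => ?_
      calc _ ≤ ∑ a, (c:ENNReal)^(s:ℝ) * Metric.ediam (t p.1.1 a) ^ (s:ℝ) := by
            refine Finset.sum_le_sum fun a _ => ?_
            rw [← ENNReal.mul_rpow_of_nonneg _ _ s.coe_nonneg]
            exact ENNReal.rpow_le_rpow ((hf p.1).ediam_image_le _) s.coe_nonneg
        _ ≤ _ := by
            rw [← Finset.mul_sum]
            gcongr
            exact ht3 _

theorem dim_le {E : Type} [MetricSpace E] {m : ℕ}
    (B : Fin m → Set E) (v : Fin m → ENNReal) (s c : NNReal) (hc : c < 1)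
    (T : Fin m → Finset (Fin m × E)) (f : Fin m × E → E → E) (hf : ∀ p, LipschitzWith c (f p))
    (hB : ∀ j, B j ⊆ ⋃ p ∈ T j, f p '' B p.1) (hv : ∀ j, Metric.ediam (B j) ^ (s:ℝ) ≤ v j)
    (hvt : ∀ j, v j ≠ ⊤)
    (C : ENNReal) (hCt : C ≠ ⊤) (hC : ∀ j, Metric.ediam (B j) ≤ C)
    (hw : ∀ j, ∑ p ∈ T j, (c:ENNReal) ^ (s:ℝ) * v p.1 ≤ v j) (j : Fin m) :
    dimH (B j) ≤ s := by
  borelize E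
  apply dimH_le_of_hausdorffMeasure_ne_top
  choose ι hι t ht1 ht2 ht3 using fun k => cover_dim B v s c T f hf hB hv C hC hw k j
  have := MeasureTheory.Measure.hausdorffMeasure_le_liminf_sum (s:ℝ) (B j) (l := Filter.atTop)
    (fun k : ℕ => (c:ENNReal)^k * C) (by
      have h1 : Filter.Tendsto (fun k : ℕ => (c:ENNReal)^k) Filter.atTop (nhds 0) :=
        ENNReal.tendsto_pow_atTop_nhds_zero_of_lt_one (by exact_mod_cast hc)
      simpa using ENNReal.Tendsto.mul_const h1 (Or.inr hCt)) t
      (Filter.Eventually.of_forall ht2) (Filter.Eventually.of_forall ht1)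
  refine ne_top_of_le_ne_top (hvt j) (this.trans ?_)
  refine Filter.liminf_le_of_frequently_le' (Filter.Frequently.of_forall fun k => ht3 k)

abbrev EE (d : ℕ) := EuclideanSpace ℝ (Fin d)

theorem vol_image {d : ℕ} (P : EE d ≃L[ℝ] EE d) (c : ℝ) (hc : 0 < c) (hP : ∀ x, ‖P x‖ = c * ‖x‖)
    (s : Set (EE d)) : MeasureTheory.volume (P '' s) = ENNReal.ofReal (c^d) * MeasureTheory.volume s := by
  let O : EE d ≃ₗᵢ[ℝ] EE d :=
    { (P.toLinearEquiv.trans (LinearEquiv.smulOfNeZero ℝ (EE d) c⁻¹ (by positivity))) with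
      norm_map' := by
        intro x
        change ‖c⁻¹ • P x‖ = ‖x‖
        rw [norm_smul, hP, norm_inv, Real.norm_of_nonneg hc.le]
        field_simp }
  have hO : ∀ x, P x = c • O x := by
    intro x
    change P x = c • (c⁻¹ • P x)
    rw [smul_inv_smul₀ hc.ne']
  have : P '' s = c • (O '' s) := by
    ext z; simp [mem_smul_set, hO]
  rw [this, MeasureTheory.Measure.addHaar_smul, finrank_euclideanSpace_fin, abs_of_pos (by positivity)]
  congr 1
  rw [LinearIsometryEquiv.image_eq_preimage_symm]
  exact O.symm.measurePreserving.measure_preimage_emb O.symm.toHomeomorph.measurableEmbedding _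

def lvl {d m : ℕ} (Q : EE d ≃L[ℝ] EE d) (D : Fin m → Fin m → Set (EE d)) (j : Fin m) :
    ℕ → Set (Fin m × EE d)
  | 0 => {(j, 0)}
  | n+1 => ⋃ p ∈ lvl Q D j n, ⋃ i, (fun e => (i, Q p.2 + e)) '' D i p.1

theorem lvl_finite {d m : ℕ} (Q : EE d ≃L[ℝ] EE d) (D : Fin m → Fin m → Set (EE d))
    (hD : ∀ i j, (D i j).Finite) (j : Fin m) (n : ℕ) : (lvl Q D j n).Finite := by
  induction n with
  | zero => exact finite_singleton _
  | succ n ih => exact ih.biUnion fun p _ => finite_iUnion fun i => (hD _ _).image _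

theorem pow_succ_apply {d : ℕ} (Q : EE d ≃L[ℝ] EE d) (n : ℕ) (x : EE d) :
    (Q^(n+1)) x = Q ((Q^n) x) := by
  rw [pow_succ']; rfl

theorem lvl_tile {d m : ℕ} (Q : EE d ≃L[ℝ] EE d) (D : Fin m → Fin m → Set (EE d))
    (A : Fin m → Set (EE d)) (htile : ∀ j, ⇑Q '' A j = ⋃ i, D i j + A i) (j : Fin m) (n : ℕ) :
    ∀ z, z ∈ ⇑(Q^n) '' A j ↔ ∃ p ∈ lvl Q D j n, ∃ a ∈ A p.1, p.2 + a = z := by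
  induction n with
  | zero =>
    intro z
    have : (⇑(Q^0) : EE d → EE d) = id := rfl
    rw [this]
    simp [lvl]
  | succ n ih =>
    intro z
    have h1 : z ∈ ⇑(Q^(n+1)) '' A j ↔ ∃ y ∈ ⇑(Q^n) '' A j, Q y = z := by
      simp [pow_succ_apply]
    rw [h1]
    constructor
    · rintro ⟨y, hy, rfl⟩
      obtain ⟨p, hp, a, ha, rfl⟩ := (ih y).1 hy
      have : Q a ∈ ⋃ i, D i p.1 + A i := htile p.1 ▸ mem_image_of_mem _ ha
      obtain ⟨i, e, he, b, hb, hab⟩ := mem_iUnion.1 this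
      refine ⟨(i, Q p.2 + e), ?_, b, hb, ?_⟩
      · exact mem_biUnion hp (mem_iUnion.2 ⟨i, e, he, rfl⟩)
      · simp only [map_add, ← hab]; abel
    · rintro ⟨q, hq, b, hb, rfl⟩
      obtain ⟨p, hp, hq⟩ := mem_iUnion₂.1 hq
      obtain ⟨i, e, he, rfl⟩ := mem_iUnion.1 hq
      have : e + b ∈ ⇑Q '' A p.1 := by
        rw [htile]; exact mem_iUnion.2 ⟨i, add_mem_add he hb⟩
      obtain ⟨a, ha, hab⟩ := this
      refine ⟨p.2 + a, (ih _).2 ⟨p, hp, a, ha, rfl⟩, ?_⟩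
      simp only [map_add, hab]; abel

theorem lvl_mem {d m : ℕ} (Q : EE d ≃L[ℝ] EE d) (D : Fin m → Fin m → Set (EE d))
    (Λ : Fin m → Set (EE d)) (hsub : ∀ i, Λ i = ⋃ j, ⇑Q '' Λ j + D i j) (j : Fin m) (n : ℕ)
    (y : EE d) (hy : y ∈ Λ j) : ∀ p ∈ lvl Q D j n, (Q^n) y + p.2 ∈ Λ p.1 := by
  induction n with
  | zero =>
    rintro p hp
    obtain rfl : p = (j, 0) := hp
    change y + 0 ∈ Λ j
    simpa using hy
  | succ n ih =>
    intro q hq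
    obtain ⟨p, hp, hq⟩ := mem_iUnion₂.1 hq
    obtain ⟨i, e, he, rfl⟩ := mem_iUnion.1 hq
    rw [hsub]
    refine mem_iUnion.2 ⟨p.1, Q ((Q^n) y + p.2), mem_image_of_mem _ (ih p hp), e, he, ?_⟩
    simp only [map_add, pow_succ_apply]; abel

theorem lvl_norm {d : ℕ} (Q : EE d ≃L[ℝ] EE d) (lam : ℝ) (hQ : ∀ x, ‖Q x‖ = lam * ‖x‖) (n : ℕ) :
    ∀ x, ‖(Q^n) x‖ = lam^n * ‖x‖ := by
  induction n with
  | zero =>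
    intro x
    have : (Q^0) x = x := rfl
    rw [this]; simp
  | succ n ih => intro x; rw [pow_succ_apply, hQ, ih]; ring

theorem main_step {d m : ℕ} (hd : 1 ≤ d) (P : EE d ≃L[ℝ] EE d) (c : ℝ) (hc : 1 < c)
    (hP : ∀ x, ‖P x‖ = c * ‖x‖) (S : Fin m → Finset (Fin m × EE d)) (A : Fin m → Set (EE d))
    (hAne : ∀ i, (interior (A i)).Nonempty) (hAcp : ∀ i, IsCompact (A i))
    (htile : ∀ j z, z ∈ P '' A j ↔ ∃ p ∈ S j, ∃ a ∈ A p.1, p.2 + a = z)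
    (hdisj : ∀ j, ∀ p ∈ S j, ∀ q ∈ S j, p ≠ q →
      Disjoint (p.2 +ᵥ interior (A p.1)) (q.2 +ᵥ interior (A q.1)))
    (hin : ∀ j, ∃ p ∈ S j, p.2 +ᵥ A p.1 ⊆ interior (P '' A j)) :
    ∀ j, dimH (frontier (A j)) < d := by
  classical
  let w : Fin m → ℝ := fun i => (MeasureTheory.volume (interior (A i))).toReal
  have hwt : ∀ i, MeasureTheory.volume (interior (A i)) ≠ ⊤ := fun i =>
    ((MeasureTheory.measure_mono interior_subset).trans_lt (hAcp i).measure_lt_top).ne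
  have hw0 : ∀ i, 0 < w i := fun i =>
    ENNReal.toReal_pos (isOpen_interior.measure_pos _ (hAne i)).ne' (hwt i)
  have hPint : ∀ j, interior (P '' A j) = P '' interior (A j) := fun j =>
    (P.toHomeomorph.image_interior (A j)).symm
  have hsum : ∀ j, ∑ p ∈ S j, w p.1 ≤ c^d * w j := by
    intro j
    have h1 := MeasureTheory.measure_biUnion_finset (μ := MeasureTheory.volume) (s := S j)
      (f := fun p => p.2 +ᵥ interior (A p.1)) (fun p hp q hq hpq => hdisj j p hp q hq hpq)
      (fun p _ => (isOpen_interior.vadd p.2).measurableSet)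
    have h2 : (⋃ p ∈ S j, p.2 +ᵥ interior (A p.1)) ⊆ P '' interior (A j) := by
      rw [← hPint]
      refine iUnion₂_subset fun p hp => interior_maximal ?_ (isOpen_interior.vadd p.2)
      rintro _ ⟨a, ha, rfl⟩
      exact (htile j _).2 ⟨p, hp, a, interior_subset ha, rfl⟩
    have h3 := MeasureTheory.measure_mono (μ := MeasureTheory.volume) h2
    rw [h1, vol_image P c (by linarith) hP] at h3
    simp only [MeasureTheory.measure_vadd] at h3
    have h4 := ENNReal.toReal_mono (ENNReal.mul_ne_top ENNReal.ofReal_ne_top (hwt j)) h3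
    rw [ENNReal.toReal_sum (fun p _ => hwt _), ENNReal.toReal_mul,
      ENNReal.toReal_ofReal (by positivity)] at h4
    exact h4
  let T : Fin m → Finset (Fin m × EE d) := fun j =>
    (S j).filter fun p => ¬ (p.2 +ᵥ A p.1 ⊆ interior (P '' A j))
  have hT : ∀ j, ∑ p ∈ T j, w p.1 < c^d * w j := by
    intro j
    refine lt_of_lt_of_le ?_ (hsum j)
    obtain ⟨p, hp, hpi⟩ := hin j
    refine Finset.sum_lt_sum_of_subset (Finset.filter_subset _ _) hp ?_ (hw0 _)
      fun _ _ _ => (hw0 _).le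
    exact fun h => (Finset.mem_filter.1 h).2 hpi
  have hs : ∃ s : ℝ, 0 < s ∧ s < d ∧ ∀ j, ∑ p ∈ T j, w p.1 ≤ c^s * w j := by
    have h1 : ∀ᶠ s in nhdsWithin (d:ℝ) (Iio d), ∀ j, ∑ p ∈ T j, w p.1 ≤ c^s * w j := by
      refine Filter.eventually_all.2 fun j => ?_
      have : Filter.Tendsto (fun s : ℝ => c^s * w j) (nhdsWithin (d:ℝ) (Iio d))
          (nhds (c^(d:ℝ) * w j)) := by
        refine Filter.Tendsto.mono_left ?_ nhdsWithin_le_nhds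
        exact ((Real.continuous_const_rpow (by linarith)).tendsto _).mul_const _
      refine (this.eventually_const_lt (u := ∑ p ∈ T j, w p.1) ?_).mono fun s h => h.le
      rw [Real.rpow_natCast]; exact hT j
    have h0 : ∀ᶠ s in nhdsWithin (d:ℝ) (Iio d), 0 < s :=
      nhdsWithin_le_nhds (lt_mem_nhds (by exact_mod_cast hd))
    obtain ⟨s, ⟨h1, h0⟩, h2⟩ := ((h1.and h0).and self_mem_nhdsWithin).exists
    exact ⟨s, h0, h2, h1⟩
  obtain ⟨s, hs0, hsd, hs⟩ := hs
  obtain ⟨C, hC0, hC⟩ : ∃ C : ℝ, 0 < C ∧ ∀ j, Metric.ediam (frontier (A j)) ≤ ENNReal.ofReal C := by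
    refine ⟨1 + ∑ j, (Metric.ediam (frontier (A j))).toReal,
      by positivity, fun j => ?_⟩
    have hb : Bornology.IsBounded (frontier (A j)) :=
      (hAcp j).isBounded.subset (hAcp j).isClosed.frontier_subset
    rw [← ENNReal.ofReal_toReal hb.ediam_ne_top]
    apply ENNReal.ofReal_le_ofReal
    have := Finset.single_le_sum (f := fun j => (Metric.ediam (frontier (A j))).toReal)
      (fun i _ => ENNReal.toReal_nonneg) (Finset.mem_univ j)
    linarith
  let K : ℝ := ∑ j, C^s / w j
  have hK0 : 0 ≤ K := Finset.sum_nonneg fun j _ => div_nonneg (by positivity) (hw0 j).le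
  have hK : ∀ j, C^s ≤ K * w j := by
    intro j
    rw [← div_le_iff₀ (hw0 j)]
    exact Finset.single_le_sum (f := fun j => C^s / w j)
      (fun i _ => div_nonneg (by positivity) (hw0 i).le) (Finset.mem_univ j)
  intro j
  have hcpos : 0 < c := by linarith
  obtain ⟨cNn, hcNn⟩ : ∃ cNn : NNReal, (cNn:ℝ) = c⁻¹ :=
    ⟨(c⁻¹).toNNReal, Real.coe_toNNReal _ (by positivity)⟩
  obtain ⟨sNn, hsNn⟩ : ∃ sNn : NNReal, (sNn:ℝ) = s := ⟨s.toNNReal, Real.coe_toNNReal _ hs0.le⟩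
  have key := dim_le (fun j => frontier (A j)) (fun j => ENNReal.ofReal (K * w j))
    sNn cNn (by
      rw [← NNReal.coe_lt_coe, hcNn]; exact inv_lt_one_of_one_lt₀ hc) T
    (fun p z => P.symm (p.2 + z)) ?_ ?_ ?_ (fun _ => ENNReal.ofReal_ne_top)
    (ENNReal.ofReal C) ENNReal.ofReal_ne_top hC ?_ j
  · refine lt_of_le_of_lt key ?_
    rw [← ENNReal.coe_natCast, ENNReal.coe_lt_coe, ← NNReal.coe_lt_coe]
    rw [hsNn]; exact_mod_cast hsd
  · intro p
    refine LipschitzWith.of_dist_le_mul fun x y => ?_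
    have := hP (P.symm (p.2 + x) - P.symm (p.2 + y))
    rw [map_sub, P.apply_symm_apply, P.apply_symm_apply, add_sub_add_left_eq_sub] at this
    rw [dist_eq_norm, dist_eq_norm, this]
    rw [hcNn, inv_mul_cancel_left₀ hcpos.ne']
  · intro j z hz
    have hzA : z ∈ A j := (hAcp j).isClosed.frontier_subset hz
    have hzi : P z ∉ interior (P '' A j) := by
      rw [hPint]
      rintro ⟨y, hy, hyz⟩
      exact hz.2 (P.injective hyz ▸ hy)
    obtain ⟨p, hp, a, ha, haz⟩ := (htile j _).1 (mem_image_of_mem P hzA)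
    refine mem_biUnion (x := p) ?_ ⟨a, ⟨subset_closure ha, fun hai => hzi ?_⟩, ?_⟩
    · refine Finset.mem_coe.2 (Finset.mem_filter.2 ⟨hp, fun h => hzi (h ⟨a, ha, haz⟩)⟩)
    · refine interior_maximal ?_ (isOpen_interior.vadd p.2) (⟨a, hai, haz⟩ : P z ∈ p.2 +ᵥ interior (A p.1))
      rintro _ ⟨b, hb, rfl⟩
      exact (htile j _).2 ⟨p, hp, b, interior_subset hb, rfl⟩
    · simp [haz]
  · intro j
    rw [hsNn]
    calc _ ≤ (ENNReal.ofReal C)^s := ENNReal.rpow_le_rpow (hC j) hs0.le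
      _ = ENNReal.ofReal (C^s) := ENNReal.ofReal_rpow_of_pos hC0
      _ ≤ _ := ENNReal.ofReal_le_ofReal (hK j)
  · intro j
    have h1 : (cNn : ENNReal) = ENNReal.ofReal c⁻¹ := by
      rw [← hcNn, ENNReal.ofReal_coe_nnreal]
    rw [h1, hsNn]
    change ∑ p ∈ T j, (ENNReal.ofReal c⁻¹)^s * ENNReal.ofReal (K * w p.1) ≤ _
    rw [ENNReal.ofReal_rpow_of_pos (by positivity), ← Finset.mul_sum,
      ← ENNReal.ofReal_sum_of_nonneg (fun p _ => mul_nonneg hK0 (hw0 _).le),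
      ← ENNReal.ofReal_mul (by positivity), ← Finset.mul_sum]
    apply ENNReal.ofReal_le_ofReal
    rw [Real.inv_rpow hcpos.le, inv_mul_le_iff₀ (by positivity)]
    calc K * ∑ p ∈ T j, w p.1 ≤ K * (c^s * w j) := by gcongr; exact hs j
      _ = _ := by ring

/-- for a self-similar tiling of `ℝ^d` (expansion `Q = λ·O` with `λ > 1`
and `O` a linear isometry, i.e. `‖Qx‖ = λ‖x‖`), the topological boundary of every
prototile has Hausdorff dimension strictly less than `d`. -/
theorem stmt_15 (d m : ℕ) (hd : 1 ≤ d) (hm : 1 ≤ m)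
    (lam : ℝ) (hlam : 1 < lam)
    (Q : EuclideanSpace ℝ (Fin d) ≃L[ℝ] EuclideanSpace ℝ (Fin d))
    (hQ : ∀ x, ‖Q x‖ = lam * ‖x‖)
    (D : Fin m → Fin m → Set (EuclideanSpace ℝ (Fin d)))
    (hDfin : ∀ i j, (D i j).Finite)
    (Λ : Fin m → Set (EuclideanSpace ℝ (Fin d)))
    (hDel : ∀ i, IsDelone (Λ i)) (hDelU : IsDelone (⋃ i, Λ i))
    (hsub : ∀ i, Λ i = ⋃ j, ⇑Q '' Λ j + D i j)
    (hdisjsub : ∀ i : Fin m, ∀ j j' : Fin m, ∀ x ∈ D i j, ∀ x' ∈ D i j',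
      (j, x) ≠ (j', x') → Disjoint (x +ᵥ ⇑Q '' Λ j) (x' +ᵥ ⇑Q '' Λ j'))
    (hprim : ∃ p : ℕ, 1 ≤ p ∧ ∀ i j : Fin m,
      0 < ((Matrix.of fun i j : Fin m => (D i j).ncard) ^ p) i j)
    (hrep : ∀ K : Set (EuclideanSpace ℝ (Fin d)), IsCompact K →
      RelativelyDense { t : EuclideanSpace ℝ (Fin d) | ∀ i, (t +ᵥ Λ i) ∩ K = Λ i ∩ K })
    (hFLC : ∀ s : Set (EuclideanSpace ℝ (Fin d)), Bornology.IsBounded s →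
      s ⊆ ((⋃ i, Λ i) - ⋃ i, Λ i) → s.Finite)
    (A : Fin m → Set (EuclideanSpace ℝ (Fin d)))
    (hAne : ∀ i, (A i).Nonempty) (hAcp : ∀ i, IsCompact (A i))
    (hAint : ∀ i, A i = closure (interior (A i)))
    (htile : ∀ j, ⇑Q '' A j = ⋃ i, D i j + A i)
    (hcover : (⋃ i, ⋃ x ∈ Λ i, x +ᵥ A i) = univ)
    (htdisj : ∀ i i' : Fin m, ∀ x ∈ Λ i, ∀ x' ∈ Λ i',
      (i, x) ≠ (i', x') → interior (x +ᵥ A i) ∩ interior (x' +ᵥ A i') = ∅) :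
    ∀ i : Fin m, dimH (frontier (A i)) < (d : ENNReal) := by
  have hIne : ∀ i, (interior (A i)).Nonempty := fun i => by
    rw [← closure_nonempty_iff, ← hAint]; exact hAne i
  choose z hz using hIne
  have : ∀ i, ∃ r > 0, Metric.ball (z i) r ⊆ interior (A i) := fun i =>
    Metric.isOpen_iff.1 isOpen_interior _ (hz i)
  choose r hr0 hr using this
  have hR : ∀ i, Metric.diam (A i) < (1 + ∑ i, Metric.diam (A i)) := by
    intro i
    have := Finset.single_le_sum (f := fun i => Metric.diam (A i))
      (fun i _ => Metric.diam_nonneg) (Finset.mem_univ i)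
    linarith
  have hn : ∃ n : ℕ, 1 ≤ n ∧ ∀ j, (1 + ∑ i, Metric.diam (A i)) < lam^n * r j := by
    have h1 : ∀ᶠ n : ℕ in Filter.atTop, ∀ j, (1 + ∑ i, Metric.diam (A i)) < lam^n * r j :=
      Filter.eventually_all.2 fun j =>
        ((tendsto_pow_atTop_atTop_of_one_lt hlam).atTop_mul_const (hr0 j)).eventually_gt_atTop _
    obtain ⟨n, h, hge⟩ := (h1.and (Filter.eventually_ge_atTop 1)).exists
    exact ⟨n, hge, h⟩
  obtain ⟨n, hn1, hn⟩ := hn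
  refine main_step hd (Q^n) (lam^n) (one_lt_pow₀ hlam (by omega)) (lvl_norm Q lam hQ n)
    (fun j => (lvl_finite Q D hDfin j n).toFinset) A (fun i => ⟨z i, hz i⟩) hAcp ?_ ?_ ?_
  · intro j x
    simpa only [Finite.mem_toFinset] using lvl_tile Q D A htile j n x
  · intro j p hp q hq hpq
    rw [Finite.mem_toFinset] at hp hq
    obtain ⟨R, _, hden⟩ := (hDel j).2
    obtain ⟨y, hy, -⟩ := hden 0
    have h := htdisj p.1 q.1 _ (lvl_mem Q D Λ hsub j n y hy p hp) _
      (lvl_mem Q D Λ hsub j n y hy q hq) (fun h => hpq (by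
        have h1 := congrArg Prod.fst h
        have h2 := congrArg Prod.snd h
        simp only [add_right_inj] at h1 h2
        exact Prod.ext h1 h2))
    rw [interior_vadd, interior_vadd] at h
    rw [Set.disjoint_left]
    rintro _ ⟨a, ha, rfl⟩ ⟨b, hb, hab⟩
    simp only [vadd_eq_add] at hab
    have : (Q^n) y + p.2 + a ∈ (∅ : Set (EuclideanSpace ℝ (Fin d))) := by
      rw [← h]
      exact ⟨⟨a, ha, rfl⟩, ⟨b, hb, by simp only [vadd_eq_add]; rw [add_assoc, hab, add_assoc]⟩⟩
    exact this
  · intro j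
    obtain ⟨p, hp, a, ha, haz⟩ := (lvl_tile Q D A htile j n _).1
      (mem_image_of_mem (Q^n) (interior_subset (hz j)))
    refine ⟨p, (Finite.mem_toFinset _).2 hp, ?_⟩
    rintro _ ⟨b, hb, rfl⟩
    rw [show interior ((Q^n) '' A j) = (Q^n) '' interior (A j) from
      ((Q^n).toHomeomorph.image_interior (A j)).symm]
    refine ⟨(Q^n).symm (p.2 + b), hr j ?_, (Q^n).apply_symm_apply _⟩
    rw [Metric.mem_ball, dist_eq_norm]
    have h1 := lvl_norm Q lam hQ n ((Q^n).symm (p.2 + b) - z j)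
    rw [map_sub, (Q^n).apply_symm_apply, ← haz, add_sub_add_left_eq_sub, ← dist_eq_norm] at h1
    have h2 := Metric.dist_le_diam_of_mem (hAcp p.1).isBounded hb ha
    have h3 : lam^n * ‖(Q^n).symm (p.2 + b) - z j‖ < lam^n * r j := by
      rw [← h1]; exact (h2.trans_lt (hR p.1)).trans (hn j)
    exact lt_of_mul_lt_mul_left h3 (by positivity)
end
end
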